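/- Let μ_X, μ_Y ∈ ℝ, σ_X, σ_Y > 0, ρ ∈ (−1,1) and n ≥ 1 an integer. The moment generating function E[e^{tS_n}] is finite for t in a neighbourhood of 0, and the cumulants of S_n are given by κ_k = (s^k/2)(k−1)![(1+ρ)^k (n + kλ₊) + (−1)^k (1−ρ)^k (n + kλ₋)] for all integers k ≥ 1; that is, the k-th derivative at t = 0 of t ↦ log E[e^{tS_n}] equals (s^k/2)(k−1)![(1+ρ)^k (n + kλ₊) + (−1)^k (1−ρ)^k (n + kλ₋)]. -/

import Mathlib

open MeasureTheory ProbabilityTheory Real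

noncomputable section

/-- Modified Bessel function of the first kind,
`I ν y = ∑_{k=0}^∞ (y/2)^{2k+ν} / (k! Γ(k+ν+1))`. -/
def besselI (ν y : ℝ) : ℝ :=
  ∑' k : ℕ, (y / 2) ^ (2 * (k : ℝ) + ν) / ((k.factorial : ℝ) * Real.Gamma ((k : ℝ) + ν + 1))

/-- The density of the noncentral chi-square distribution with `r` degrees of freedom and
noncentrality parameter `lam` (for `lam = 0`, the chi-square density). -/
def ncChiSqPdf (r lam x : ℝ) : ℝ :=
  if x ≤ 0 then 0
  else if lam = 0 then x ^ (r / 2 - 1) * Real.exp (-x / 2) / (2 ^ (r / 2) * Real.Gamma (r / 2))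
  else (1 / 2) * Real.exp (-(x + lam) / 2) * (x / lam) ^ (r / 4 - 1 / 2) *
    besselI (r / 2 - 1) (Real.sqrt (lam * x))

/-- The noncentral chi-square distribution `χ'²_r(lam)` as a measure on `ℝ`. -/
def ncChiSq (r lam : ℝ) : Measure ℝ :=
  volume.withDensity fun x => ENNReal.ofReal (ncChiSqPdf r lam x)

/-- The law of the difference `T = V₁ - V₂` of independent noncentral chi-square random
variables `V₁ ~ χ'²_r(λ₁)` and `V₂ ~ χ'²_r(λ₂)`. -/
def ncChiSqDiff (r lam1 lam2 : ℝ) : Measure ℝ :=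
  Measure.map (fun p : ℝ × ℝ => p.1 - p.2) ((ncChiSq r lam1).prod (ncChiSq r lam2))

/-- The bivariate normal distribution with mean vector `(μX, μY)`, variances `(σX², σY²)` and
correlation coefficient `ρ`, realised as the law of
`(μX + σX N₁, μY + σY (ρ N₁ + √(1-ρ²) N₂))` for independent standard normals `N₁, N₂`. -/
def binormal (μX μY σX σY ρ : ℝ) : Measure (ℝ × ℝ) :=
  Measure.map (fun p : ℝ × ℝ =>
      (μX + σX * p.1, μY + σY * (ρ * p.1 + Real.sqrt (1 - ρ ^ 2) * p.2)))
    ((gaussianReal 0 1).prod (gaussianReal 0 1))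

/-- The law of the product `Z = XY` of bivariate normal random variables. -/
def prodNormal (μX μY σX σY ρ : ℝ) : Measure ℝ :=
  Measure.map (fun p : ℝ × ℝ => p.1 * p.2) (binormal μX μY σX σY ρ)

/-- The law of the sum `Sₙ = Z₁ + ⋯ + Zₙ` of `n` independent copies of `Z = XY`. -/
def sumProdNormal (n : ℕ) (μX μY σX σY ρ : ℝ) : Measure ℝ :=
  Measure.map (fun x : Fin n → ℝ => ∑ i, x i)
    (Measure.pi fun _ : Fin n => prodNormal μX μY σX σY ρ)

/-- The Gaussian integral `E[exp(a N² + b N + c)]` for a standard normal `N` and `2a < 1`. -/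
theorem lintegral_exp_quadratic_gaussianReal (a b c : ℝ) (ha : 0 < 1 - 2 * a) :
    ∫⁻ x, ENNReal.ofReal (exp (a * x ^ 2 + b * x + c)) ∂(gaussianReal 0 1) =
      ENNReal.ofReal ((√(1 - 2 * a))⁻¹ * exp (c + b ^ 2 / (2 * (1 - 2 * a)))) := by
  have hv : (1 - 2 * a)⁻¹.toNNReal ≠ 0 := by simpa using ha
  have hvc : ((1 - 2 * a)⁻¹.toNNReal : ℝ) = (1 - 2 * a)⁻¹ :=
    Real.coe_toNNReal _ (inv_nonneg.2 ha.le)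
  have hpt (x : ℝ) : gaussianPDF 0 1 x * ENNReal.ofReal (exp (a * x ^ 2 + b * x + c)) =
      ENNReal.ofReal ((√(1 - 2 * a))⁻¹ * exp (c + b ^ 2 / (2 * (1 - 2 * a)))) *
        gaussianPDF (b * (1 - 2 * a)⁻¹) (1 - 2 * a)⁻¹.toNNReal x := by
    rw [gaussianPDF, gaussianPDF, ← ENNReal.ofReal_mul (gaussianPDFReal_nonneg _ _ _),
      ← ENNReal.ofReal_mul (by positivity)]
    congr 1
    simp only [gaussianPDFReal, hvc, NNReal.coe_one]
    rw [mul_assoc, ← exp_add, Real.sqrt_mul (by positivity) (1 - 2 * a)⁻¹, Real.sqrt_inv,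
      mul_one, mul_inv, inv_inv, mul_mul_mul_comm, ← exp_add]
    have hs : (√(1 - 2 * a))⁻¹ * ((√(2 * π))⁻¹ * √(1 - 2 * a)) = (√(2 * π))⁻¹ := by
      have := (Real.sqrt_pos.2 ha).ne'
      field_simp
    have he : -(x - 0) ^ 2 / 2 + (a * x ^ 2 + b * x + c) =
        c + b ^ 2 / (2 * (1 - 2 * a)) +
          -(x - b * (1 - 2 * a)⁻¹) ^ 2 / (2 * (1 - 2 * a)⁻¹) := by
      have := ha.ne'
      field_simp
      ring
    rw [hs, mul_one, he]
  rw [gaussianReal_of_var_ne_zero 0 one_ne_zero,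
    lintegral_withDensity_eq_lintegral_mul _ (measurable_gaussianPDF 0 1) (by fun_prop)]
  simp only [Pi.mul_apply, hpt]
  rw [lintegral_const_mul _ (measurable_gaussianPDF _ _), lintegral_gaussianPDF_eq_one _ hv,
    mul_one]

/-- The cumulant generating function of `(a/2) V` for a noncentral chi-square variable `V` with
one degree of freedom and noncentrality `l`, in closed form. -/
def chiSqCgf (a l t : ℝ) : ℝ :=
  -(1 / 2) * log (1 - a * t) + l / 2 * ((1 - a * t)⁻¹ - 1)

theorem contDiffAt_chiSqCgf (a l : ℝ) {t : ℝ} (ht : 1 - a * t ≠ 0) (k : WithTop ℕ∞) :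
    ContDiffAt ℝ k (chiSqCgf a l) t := by
  unfold chiSqCgf
  have h : ContDiffAt ℝ k (fun t : ℝ => 1 - a * t) t := by fun_prop
  exact (contDiffAt_const.mul (h.log ht)).add
    (contDiffAt_const.mul ((h.inv ht).sub contDiffAt_const))

theorem iteratedDeriv_chiSqCgf (a l : ℝ) (k : ℕ) {t : ℝ} (ht : 0 < 1 - a * t) :
    iteratedDeriv (k + 1) (chiSqCgf a l) t =
      a ^ (k + 1) / 2 * (k.factorial : ℝ) *
        (((1 - a * t) ^ (k + 1))⁻¹ + l * ((k : ℝ) + 1) * ((1 - a * t) ^ (k + 2))⁻¹) := by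
  have hd (t : ℝ) : HasDerivAt (fun t : ℝ => 1 - a * t) (-a) t := by
    simpa using ((hasDerivAt_id t).const_mul a).const_sub 1
  induction k generalizing t with
  | zero =>
    rw [zero_add, iteratedDeriv_one]
    have h : HasDerivAt (chiSqCgf a l) _ t := (((hd t).log ht.ne').const_mul (-(1 / 2))).add
      ((((hd t).inv ht.ne').sub_const 1).const_mul (l / 2))
    rw [h.deriv]
    have := ht.ne'
    simp only [Nat.factorial_zero, Nat.cast_one, Nat.cast_zero]
    field_simp
    ring
  | succ k ih =>
    rw [iteratedDeriv_succ]
    have hev : ∀ᶠ u in nhds t, 0 < 1 - a * u :=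
      (by fun_prop : ContinuousAt (fun u : ℝ => 1 - a * u) t).eventually (lt_mem_nhds ht)
    rw [Filter.EventuallyEq.deriv_eq (hev.mono fun u hu => ih hu)]
    have h := (((((hd t).pow (k + 1)).inv (pow_ne_zero _ ht.ne')).add
      ((((hd t).pow (k + 2)).inv (pow_ne_zero _ ht.ne')).const_mul
        (l * ((k : ℝ) + 1)))).const_mul (a ^ (k + 1) / 2 * (k.factorial : ℝ)))
    refine h.deriv.trans ?_
    have := ht.ne'
    simp only [Nat.factorial_succ, Nat.cast_mul, Nat.cast_add, Nat.cast_one, Nat.cast_ofNat,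
      Nat.add_sub_cancel, Pi.pow_apply, show k + 2 - 1 = k + 1 from rfl]
    field_simp
    ring

/-- The moment generating function of the product of two correlated normal variables. -/
theorem lintegral_exp_mul_prodNormal (μX μY σX σY ρ t : ℝ) (hσX : 0 < σX) (hσY : 0 < σY)
    (hρ : ρ ∈ Set.Ioo (-1 : ℝ) 1) (h₁ : 0 < 1 - σX * σY * (1 + ρ) * t)
    (h₂ : 0 < 1 - -(σX * σY * (1 - ρ)) * t) :
    ∫⁻ z, ENNReal.ofReal (exp (t * z)) ∂(prodNormal μX μY σX σY ρ) =
      ENNReal.ofReal (exp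
        (chiSqCgf (σX * σY * (1 + ρ)) (1 / (2 * (1 + ρ)) * (μX / σX + μY / σY) ^ 2) t +
          chiSqCgf (-(σX * σY * (1 - ρ))) (1 / (2 * (1 - ρ)) * (μX / σX - μY / σY) ^ 2) t)) := by
  obtain ⟨hρ₁, hρ₂⟩ := hρ
  have hp : 0 < 1 + ρ := by linarith
  have hm : 0 < 1 - ρ := by linarith
  have hr : √(1 - ρ ^ 2) ^ 2 = 1 - ρ ^ 2 := Real.sq_sqrt (by nlinarith)
  have hD : 1 - 2 * (t * σX * σY * ρ + t ^ 2 * σX ^ 2 * σY ^ 2 * (1 - ρ ^ 2) / 2) =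
      (1 - σX * σY * (1 + ρ) * t) * (1 - -(σX * σY * (1 - ρ)) * t) := by ring
  have hinner (x : ℝ) :
      ∫⁻ y, ENNReal.ofReal (exp (t * ((μX + σX * x) * (μY + σY * (ρ * x + √(1 - ρ ^ 2) * y)))))
        ∂(gaussianReal 0 1) =
      ENNReal.ofReal (exp ((t * σX * σY * ρ + t ^ 2 * σX ^ 2 * σY ^ 2 * (1 - ρ ^ 2) / 2) * x ^ 2 +
        (t * (σX * μY + μX * σY * ρ) + t ^ 2 * μX * σX * σY ^ 2 * (1 - ρ ^ 2)) * x +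
        (t * μX * μY + t ^ 2 * μX ^ 2 * σY ^ 2 * (1 - ρ ^ 2) / 2))) := by
    have h := lintegral_exp_quadratic_gaussianReal 0 (t * (μX + σX * x) * σY * √(1 - ρ ^ 2))
      (t * (μX + σX * x) * (μY + σY * (ρ * x))) (by norm_num)
    convert h using 4
    · ring_nf
    · simp only [mul_zero, sub_zero, Real.sqrt_one, inv_one, one_mul, mul_pow, hr]
      congr 1
      ring
  rw [prodNormal, lintegral_map (by fun_prop) (by fun_prop), binormal,
    lintegral_map (by fun_prop) (by fun_prop), lintegral_prod _ (by fun_prop)]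
  simp only [hinner]
  rw [lintegral_exp_quadratic_gaussianReal _ _ _ (by rw [hD]; positivity), hD]
  congr 1
  have hsq : (√((1 - σX * σY * (1 + ρ) * t) * (1 - -(σX * σY * (1 - ρ)) * t)))⁻¹ =
      exp (-(1 / 2) * log (1 - σX * σY * (1 + ρ) * t) +
        -(1 / 2) * log (1 - -(σX * σY * (1 - ρ)) * t)) := by
    rw [← mul_add, ← Real.log_mul h₁.ne' h₂.ne', Real.sqrt_eq_rpow,
      ← Real.rpow_neg (by positivity), Real.rpow_def_of_pos (by positivity), mul_comm]
  have hquad : (t * μX * μY + t ^ 2 * μX ^ 2 * σY ^ 2 * (1 - ρ ^ 2) / 2) +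
      (t * (σX * μY + μX * σY * ρ) + t ^ 2 * μX * σX * σY ^ 2 * (1 - ρ ^ 2)) ^ 2 /
        (2 * ((1 - σX * σY * (1 + ρ) * t) * (1 - -(σX * σY * (1 - ρ)) * t))) =
      1 / (2 * (1 + ρ)) * (μX / σX + μY / σY) ^ 2 / 2 * ((1 - σX * σY * (1 + ρ) * t)⁻¹ - 1) +
      1 / (2 * (1 - ρ)) * (μX / σX - μY / σY) ^ 2 / 2 *
        ((1 - -(σX * σY * (1 - ρ)) * t)⁻¹ - 1) := by
    clear hsq hD hinner
    generalize hA : 1 - σX * σY * (1 + ρ) * t = A at h₁ ⊢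
    generalize hB : 1 - -(σX * σY * (1 - ρ)) * t = B at h₂ ⊢
    have hX := hσX.ne'
    have hY := hσY.ne'
    have hp' := hp.ne'
    have hm' := hm.ne'
    have h₁' := h₁.ne'
    have h₂' := h₂.ne'
    field_simp
    subst hA hB
    ring
  rw [hsq, ← exp_add, hquad, chiSqCgf, chiSqCgf, add_add_add_comm]

theorem integrable_and_integral_of_lintegral_ofReal {Ω : Type*} [MeasurableSpace Ω]
    {μ : Measure Ω} {f : Ω → ℝ} {m : ℝ} (hf : Measurable f) (hf₀ : ∀ x, 0 ≤ f x) (hm : 0 ≤ m)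
    (h : ∫⁻ x, ENNReal.ofReal (f x) ∂μ = ENNReal.ofReal m) :
    Integrable f μ ∧ ∫ x, f x ∂μ = m := by
  refine ⟨⟨hf.aestronglyMeasurable, ?_⟩, ?_⟩
  · rw [hasFiniteIntegral_iff_ofReal (.of_forall hf₀), h]
    exact ENNReal.ofReal_lt_top
  · rw [integral_eq_lintegral_of_nonneg_ae (.of_forall hf₀) hf.aestronglyMeasurable, h,
      ENNReal.toReal_ofReal hm]

instance isProbabilityMeasure_prodNormal (μX μY σX σY ρ : ℝ) :
    IsProbabilityMeasure (prodNormal μX μY σX σY ρ) := by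
  have : IsProbabilityMeasure (binormal μX μY σX σY ρ) :=
    Measure.isProbabilityMeasure_map (by fun_prop)
  exact Measure.isProbabilityMeasure_map (by fun_prop)

/-- The moment generating function of `Sₙ` is finite and equals the `n`-th power of that of `Z`. -/
theorem integrable_and_integral_exp_mul_sumProdNormal (n : ℕ) {μX μY σX σY ρ t : ℝ}
    (h : Integrable (fun z => exp (t * z)) (prodNormal μX μY σX σY ρ)) :
    Integrable (fun x => exp (t * x)) (sumProdNormal n μX μY σX σY ρ) ∧
      ∫ x, exp (t * x) ∂(sumProdNormal n μX μY σX σY ρ) =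
        (∫ z, exp (t * z) ∂(prodNormal μX μY σX σY ρ)) ^ n := by
  have hprod (x : Fin n → ℝ) : exp (t * ∑ i, x i) = ∏ i, exp (t * x i) := by
    rw [Finset.mul_sum, Real.exp_sum]
  constructor
  · rw [sumProdNormal, integrable_map_measure (by fun_prop) (by fun_prop)]
    simp only [Function.comp_def, hprod]
    exact Integrable.fintype_prod fun _ => h
  · rw [sumProdNormal, integral_map (by fun_prop) (by fun_prop)]
    simp only [hprod]
    simpa using integral_fintype_prod_eq_pow (ι := Fin n) (μ := prodNormal μX μY σX σY ρ)
      (fun z => exp (t * z))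

/-- Let `μX, μY ∈ ℝ`, `σX, σY > 0`, `ρ ∈ (-1,1)` and `n ≥ 1`. The moment
generating function `E[e^{t Sₙ}]` is finite for `t` in a neighbourhood of `0`, and the
cumulants of `Sₙ` (the derivatives at `t = 0` of `t ↦ log E[e^{t Sₙ}]`) are given by
`κ_k = (s^k/2)(k-1)! [(1+ρ)^k (n + kλ₊) + (-1)^k (1-ρ)^k (n + kλ₋)]` for all integers
`k ≥ 1`, where `s = σX σY`, `λ₊ = (n/(2(1+ρ)))(μX/σX + μY/σY)²` and
`λ₋ = (n/(2(1-ρ)))(μX/σX - μY/σY)²`. -/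
theorem sumProdNormal_cumulants (μX μY σX σY ρ : ℝ) (hσX : 0 < σX) (hσY : 0 < σY)
    (hρ : ρ ∈ Set.Ioo (-1 : ℝ) 1) (n : ℕ) (hn : 1 ≤ n) :
    (∃ ε : ℝ, 0 < ε ∧ ∀ t : ℝ, |t| < ε →
      Integrable (fun x => Real.exp (t * x)) (sumProdNormal n μX μY σX σY ρ)) ∧
    ∀ k : ℕ, 1 ≤ k →
      iteratedDeriv k
          (fun t => Real.log (∫ x, Real.exp (t * x) ∂(sumProdNormal n μX μY σX σY ρ))) 0 =
        (σX * σY) ^ k / 2 * ((k - 1).factorial : ℝ) *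
          ((1 + ρ) ^ k *
              ((n : ℝ) + (k : ℝ) * ((n : ℝ) / (2 * (1 + ρ)) * (μX / σX + μY / σY) ^ 2)) +
            (-1) ^ k * (1 - ρ) ^ k *
              ((n : ℝ) + (k : ℝ) * ((n : ℝ) / (2 * (1 - ρ)) * (μX / σX - μY / σY) ^ 2))) := by
  obtain ⟨hρ₁, hρ₂⟩ := id hρ
  have hs : 0 < σX * σY := mul_pos hσX hσY
  have hdom (t : ℝ) (ht : |t| < (2 * (σX * σY))⁻¹) :
      0 < 1 - σX * σY * (1 + ρ) * t ∧ 0 < 1 - -(σX * σY * (1 - ρ)) * t := by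
    have h : |t| * (2 * (σX * σY)) < 1 := by
      rwa [← lt_div_iff₀ (by positivity), one_div]
    have h' : |σX * σY * t| < 1 / 2 := by
      rw [abs_mul, abs_of_pos hs]
      linarith
    obtain ⟨h₁, h₂⟩ := abs_lt.1 h'
    constructor <;> nlinarith
  have hZ (t : ℝ) (ht : |t| < (2 * (σX * σY))⁻¹) :=
    integrable_and_integral_of_lintegral_ofReal (by fun_prop) (fun _ => (exp_pos _).le)
      (exp_pos _).le (lintegral_exp_mul_prodNormal μX μY σX σY ρ t hσX hσY hρ
        (hdom t ht).1 (hdom t ht).2)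
  have hε : 0 < (2 * (σX * σY))⁻¹ := by positivity
  refine ⟨⟨_, hε, fun t ht =>
    (integrable_and_integral_exp_mul_sumProdNormal n (hZ t ht).1).1⟩, fun k hk => ?_⟩
  have hev : (fun t => log (∫ x, exp (t * x) ∂(sumProdNormal n μX μY σX σY ρ))) =ᶠ[nhds 0]
      fun t => (n : ℝ) *
        (chiSqCgf (σX * σY * (1 + ρ)) (1 / (2 * (1 + ρ)) * (μX / σX + μY / σY) ^ 2) t +
          chiSqCgf (-(σX * σY * (1 - ρ))) (1 / (2 * (1 - ρ)) * (μX / σX - μY / σY) ^ 2) t) := by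
    filter_upwards [Metric.ball_mem_nhds (0 : ℝ) hε] with t ht
    have ht' : |t| < (2 * (σX * σY))⁻¹ := by simpa using ht
    rw [(integrable_and_integral_exp_mul_sumProdNormal n (hZ t ht').1).2, (hZ t ht').2,
      Real.log_pow, Real.log_exp]
  obtain ⟨j, rfl⟩ : ∃ j, k = j + 1 := ⟨k - 1, by omega⟩
  rw [hev.iteratedDeriv_eq, iteratedDeriv_const_mul_field,
    iteratedDeriv_fun_add (contDiffAt_chiSqCgf _ _ (by simp) _)
      (contDiffAt_chiSqCgf _ _ (by simp) _),
    iteratedDeriv_chiSqCgf _ _ _ (by simp), iteratedDeriv_chiSqCgf _ _ _ (by simp)]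
  simp only [mul_zero, sub_zero, one_pow, inv_one, mul_one, Nat.add_sub_cancel, Nat.cast_add,
    Nat.cast_one]
  rw [neg_pow (σX * σY * (1 - ρ)), mul_pow (σX * σY) (1 + ρ), mul_pow (σX * σY) (1 - ρ)]
  ring

end
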